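/- arXiv:2103.04604 — 2 statements merged into one kernel-verified Lean document; each statement's English description precedes it below -/
import Mathlib

section
/- Let $\rho\in(0,1)$, $\epsilon>0$, $r=\frac{\log(2/\epsilon)}{\log(1/\rho)}$, and $\delta=10^{-3r-1}\epsilon^3$. If $f:\{0,1\}^n\to\{0,1\}$ is an $(r,\delta)$-global Boolean function with respect to $\mu_p$ (for $p\in(0,1/2]$) with $\mu_p(f)<\delta$, then its noise stability satisfies $\mathrm{Stab}_\rho(f)=\langle f,\mathrm{T}_\rho f\rangle_{\mu_p}\le\epsilon\,\mu_p(f)$. -/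
open Finset

/-- Weight of a point of the `p`-biased cube. -/
noncomputable def cubeWt {n : ℕ} (p : ℝ) (x : Fin n → Bool) : ℝ :=
  ∏ i, if x i then p else 1 - p

/-- Expectation with respect to the `p`-biased measure on `{0,1}ⁿ`. -/
noncomputable def cubeE {n : ℕ} (p : ℝ) (f : (Fin n → Bool) → ℝ) : ℝ :=
  ∑ x : Fin n → Bool, cubeWt p x * f x

/-- The `p`-biased Fourier character `χ_S`. -/
noncomputable def chi {n : ℕ} (p : ℝ) (S : Finset (Fin n)) (x : Fin n → Bool) : ℝ :=
  ∏ i ∈ S, ((if x i then (1 : ℝ) else 0) - p) / Real.sqrt (p * (1 - p))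

/-- The `p`-biased Fourier coefficient `f̂(S)`. -/
noncomputable def fhat {n : ℕ} (p : ℝ) (f : (Fin n → Bool) → ℝ) (S : Finset (Fin n)) : ℝ :=
  cubeE p (fun x => f x * chi p S x)

/-- Truncation of `f` to Fourier levels at most `r`. -/
noncomputable def trunc {n : ℕ} (p : ℝ) (f : (Fin n → Bool) → ℝ) (r : ℕ) :
    (Fin n → Bool) → ℝ :=
  fun x => ∑ T ∈ Finset.univ.filter (fun T : Finset (Fin n) => T.card ≤ r),
    fhat p f T * chi p T x

/-- `cubeRestrict S B f` fixes the coordinates in `S` according to the indicator of `B`. -/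
def cubeRestrict {n : ℕ} (S B : Finset (Fin n)) (f : (Fin n → Bool) → ℝ) :
    (Fin n → Bool) → ℝ :=
  fun y => f (fun i => if i ∈ S then decide (i ∈ B) else y i)


namespace GH

/-- Product kernel. -/
noncomputable def kp {n : ℕ} (k : Bool → Bool → ℝ) (s x : Fin n → Bool) : ℝ := ∏ i, k (s i) (x i)

/-- Product function. -/
noncomputable def w1 {n : ℕ} (g : Bool → ℝ) (x : Fin n → Bool) : ℝ := ∏ i, g (x i)

lemma kp_cons {n : ℕ} (k : Bool → Bool → ℝ) (a b : Bool) (s x : Fin n → Bool) :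
    kp k (Fin.cons a s : Fin (n+1) → Bool) (Fin.cons b x : Fin (n+1) → Bool) = k a b * kp k s x := by
  simp [kp, Fin.prod_univ_succ]

lemma w1_cons {n : ℕ} (g : Bool → ℝ) (b : Bool) (x : Fin n → Bool) :
    w1 g (Fin.cons b x : Fin (n+1) → Bool) = g b * w1 g x := by
  simp [w1, Fin.prod_univ_succ]

lemma sum_cons {n : ℕ} (G : (Fin (n+1) → Bool) → ℝ) :
    ∑ x, G x = ∑ y : Fin n → Bool, (G (Fin.cons true y) + G (Fin.cons false y)) := by
  rw [← (Fin.consEquiv (fun _ : Fin (n+1) => Bool)).sum_comp, Fintype.sum_prod_type,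
    Fintype.sum_bool, sum_add_distrib]
  rfl

lemma sum_prod {n : ℕ} (g : Fin n → Bool → ℝ) :
    ∑ x : Fin n → Bool, ∏ i, g i (x i) = ∏ i, (g i true + g i false) := by
  have := Finset.prod_univ_sum (fun _ : Fin n => (univ : Finset Bool)) g
  simp only [Fintype.piFinset_univ, Fintype.sum_bool] at this
  exact this.symm

lemma kp_nonneg {n : ℕ} (k : Bool → Bool → ℝ) (hk : ∀ a b, 0 ≤ k a b) (s x : Fin n → Bool) :
    0 ≤ kp k s x := prod_nonneg fun _ _ => hk _ _

lemma w1_nonneg {n : ℕ} (k : Bool → ℝ) (hk : ∀ a, 0 ≤ k a) (s : Fin n → Bool) :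
    0 ≤ w1 k s := prod_nonneg fun _ _ => hk _

noncomputable def wb (p : ℝ) (b : Bool) : ℝ := if b then p else 1 - p
noncomputable def ph (p : ℝ) (b : Bool) : ℝ := ((if b then (1 : ℝ) else 0) - p) / Real.sqrt (p * (1 - p))
noncomputable def ck (p : ℝ) (a b : Bool) : ℝ := if a then ph p b else 1
noncomputable def lek (a b : Bool) : ℝ := if a then (if b then 1 else 0) else 1
noncomputable def K (p : ℝ) (a b : Bool) : ℝ := if a then 2 * (p * (1 - p)) else wb p b
noncomputable def kap (a b : Bool) : ℝ := if a then (if b then 4 else 0) else (if b then 4 else 1)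
noncomputable def tw (c : ℝ) (b : Bool) : ℝ := if b then c else 1

noncomputable def fh {n : ℕ} (p : ℝ) (f : (Fin n → Bool) → ℝ) (t : Fin n → Bool) : ℝ :=
  ∑ x, w1 (wb p) x * (kp (ck p) t x * f x)

lemma sg_pos {p : ℝ} (hp0 : 0 < p) (hp : p ≤ 1 / 2) : 0 < p * (1 - p) := mul_pos hp0 (by linarith)

lemma wb_nonneg {p : ℝ} (hp0 : 0 < p) (hp : p ≤ 1 / 2) (b : Bool) : 0 ≤ wb p b := by
  cases b <;> simp [wb] <;> linarith

lemma K_nonneg {p : ℝ} (hp0 : 0 < p) (hp : p ≤ 1 / 2) (a b : Bool) : 0 ≤ K p a b := by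
  have := sg_pos hp0 hp
  have := wb_nonneg hp0 hp b
  cases a <;> simp only [K] <;> simp <;> linarith

/-- one-variable facts -/
lemma one_a {p : ℝ} (hp0 : 0 < p) (hp : p ≤ 1 / 2) (u v : ℝ) :
    (p * u + (1 - p) * v) ^ 2 + (p * (ph p true * u) + (1 - p) * (ph p false * v)) ^ 2
      = p * u ^ 2 + (1 - p) * v ^ 2 := by
  have h := sg_pos hp0 hp
  have hs : Real.sqrt (p * (1 - p)) ≠ 0 := (Real.sqrt_pos.2 h).ne'
  have hsq := Real.sq_sqrt h.le
  set σ := Real.sqrt (p * (1 - p))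
  have : p * (ph p true * u) + (1 - p) * (ph p false * v) = σ * (u - v) := by
    simp only [ph, if_true, Bool.false_eq_true, if_false]
    change p * ((1 - p) / σ * u) + (1 - p) * ((0 - p) / σ * v) = _
    field_simp
    rw [hsq]; ring
  rw [this, mul_pow, hsq]; ring

lemma one_b {p : ℝ} (hp0 : 0 < p) (hp : p ≤ 1 / 2) (u v : ℝ) :
    (p * (ph p true * u) + (1 - p) * (ph p false * v)) ^ 2
      ≤ 2 * (p * (1 - p)) * u ^ 2 + 2 * (p * (1 - p)) * v ^ 2 := by
  have h1 := one_a hp0 hp u v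
  have h := sg_pos hp0 hp
  have : (p * (ph p true * u) + (1 - p) * (ph p false * v)) ^ 2 = p * (1 - p) * (u - v) ^ 2 := by
    linear_combination h1
  rw [this]
  nlinarith [mul_nonneg h.le (sq_nonneg (u + v))]

lemma one_c {p : ℝ} (hp0 : 0 < p) (hp : p ≤ 1 / 2) (A B C D : ℝ) :
    p * ((A + ph p true * B) ^ 2 * (C + ph p true * D) ^ 2)
      + (1 - p) * ((A + ph p false * B) ^ 2 * (C + ph p false * D) ^ 2)
    ≤ A ^ 2 * C ^ 2 + 4 * (A ^ 2 * D ^ 2) + 4 * (B ^ 2 * C ^ 2)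
      + 3 / (p * (1 - p)) * (B ^ 2 * D ^ 2) := by
  have h := sg_pos hp0 hp
  have hs : Real.sqrt (p * (1 - p)) ≠ 0 := (Real.sqrt_pos.2 h).ne'
  have hsq := Real.sq_sqrt h.le
  have hq : (1 - p) ≠ 0 := by linarith
  have e1 : ph p true = (1 - p) / Real.sqrt (p * (1 - p)) := by simp [ph]
  have e0 : ph p false = - p / Real.sqrt (p * (1 - p)) := by simp [ph]
  set σ := Real.sqrt (p * (1 - p))
  have m1 : p * ph p true + (1 - p) * ph p false = 0 := by
    rw [e1, e0]; field_simp; ring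
  have m2 : p * ph p true ^ 2 + (1 - p) * ph p false ^ 2 = 1 := by
    rw [e1, e0, div_pow, div_pow, hsq]; field_simp; ring
  have m3 : (p * ph p true ^ 3 + (1 - p) * ph p false ^ 3) ^ 2 ≤ 1 / (p * (1 - p)) := by
    have : p * ph p true ^ 3 + (1 - p) * ph p false ^ 3 = (1 - 2 * p) / σ := by
      rw [e1, e0]
      have : σ ^ 3 = p * (1 - p) * σ := by rw [pow_succ, hsq]
      rw [div_pow, div_pow, this]
      field_simp; ring
    rw [this, div_pow, hsq]
    gcongr
    nlinarith
  have m4 : p * ph p true ^ 4 + (1 - p) * ph p false ^ 4 ≤ 1 / (p * (1 - p)) := by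
    have : p * ph p true ^ 4 + (1 - p) * ph p false ^ 4 = (1 - 3 * (p * (1 - p))) / (p * (1 - p)) := by
      rw [e1, e0]
      have : σ ^ 4 = (p * (1 - p)) ^ 2 := by rw [← hsq]; ring
      rw [div_pow, div_pow, this]
      field_simp; ring
    rw [this]
    gcongr
    linarith
  generalize ph p true = a at *
  generalize ph p false = b at *
  set M3 := p * a ^ 3 + (1 - p) * b ^ 3 with hM3
  set M4 := p * a ^ 4 + (1 - p) * b ^ 4 with hM4
  have expand : p * ((A + a * B) ^ 2 * (C + a * D) ^ 2) + (1 - p) * ((A + b * B) ^ 2 * (C + b * D) ^ 2)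
      = A ^ 2 * C ^ 2 + (A ^ 2 * D ^ 2 + B ^ 2 * C ^ 2 + 4 * (A * B * C * D))
        + 2 * M3 * (A * B * D ^ 2 + B ^ 2 * C * D) + M4 * (B ^ 2 * D ^ 2) := by
    rw [hM3, hM4]
    linear_combination (2 * A ^ 2 * C * D + 2 * A * B * C ^ 2) * m1
      + (A ^ 2 * D ^ 2 + B ^ 2 * C ^ 2 + 4 * (A * B * C * D)) * m2
  rw [expand]
  have k1 : 2 * (A * B * C * D) ≤ A ^ 2 * D ^ 2 + B ^ 2 * C ^ 2 := by
    nlinarith [sq_nonneg (A * D - B * C)]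
  have k2 : 2 * M3 * (A * B * D ^ 2) ≤ A ^ 2 * D ^ 2 + M3 ^ 2 * (B ^ 2 * D ^ 2) := by
    nlinarith [sq_nonneg (A * D - M3 * (B * D))]
  have k3 : 2 * M3 * (B ^ 2 * C * D) ≤ B ^ 2 * C ^ 2 + M3 ^ 2 * (B ^ 2 * D ^ 2) := by
    nlinarith [sq_nonneg (B * C - M3 * (B * D))]
  have k4 : M3 ^ 2 * (B ^ 2 * D ^ 2) ≤ 1 / (p * (1 - p)) * (B ^ 2 * D ^ 2) := by gcongr
  have k5 : M4 * (B ^ 2 * D ^ 2) ≤ 1 / (p * (1 - p)) * (B ^ 2 * D ^ 2) := by gcongr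
  have k6 : 3 / (p * (1 - p)) * (B ^ 2 * D ^ 2) = 3 * (1 / (p * (1 - p)) * (B ^ 2 * D ^ 2)) := by ring
  rw [k6]
  linarith

lemma fh_cons {p : ℝ} {n : ℕ} (f : (Fin (n+1) → Bool) → ℝ) (a : Bool) (t : Fin n → Bool) :
    fh p f (Fin.cons a t : Fin (n+1) → Bool) =
      fh p (fun y => p * (ck p a true * f (Fin.cons true y))
        + (1 - p) * (ck p a false * f (Fin.cons false y))) t := by
  unfold fh
  rw [sum_cons]
  refine sum_congr rfl fun y _ => ?_
  simp only [w1_cons, kp_cons]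
  have h1 : wb p true = p := by simp [wb]
  have h2 : wb p false = 1 - p := by simp [wb]
  rw [h1, h2]
  ring

lemma bessel {p : ℝ} (hp0 : 0 < p) (hp : p ≤ 1 / 2) {n : ℕ} : ∀ (f : (Fin n → Bool) → ℝ) (s : Fin n → Bool),
    ∑ t, kp lek s t * fh p f t ^ 2 ≤ ∑ x, kp (K p) s x * f x ^ 2 := by
  induction n with
  | zero =>
    intro f s
    simp [kp, fh, w1]
  | succ n ih =>
    intro f s
    obtain ⟨a, s, rfl⟩ : ∃ (a : Bool) (s' : Fin n → Bool), s = Fin.cons a s' :=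
      ⟨s 0, Fin.tail s, (Fin.cons_self_tail s).symm⟩
    rw [sum_cons, sum_cons]
    simp only [kp_cons, fh_cons]
    cases a
    · simp only [lek, Bool.false_eq_true, if_false, one_mul, K, ck, if_true]
      rw [sum_add_distrib]
      refine (add_le_add (ih _ s) (ih _ s)).trans ?_
      rw [← sum_add_distrib]
      refine sum_le_sum fun y _ => ?_
      have := one_a hp0 hp (f (Fin.cons true y)) (f (Fin.cons false y))
      simp only [wb, if_true, Bool.false_eq_true, if_false]
      refine le_of_eq ?_
      linear_combination kp (K p) s y * this
    · simp only [lek, Bool.false_eq_true, if_false, one_mul, K, ck, if_true, zero_mul, add_zero]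
      refine (ih _ s).trans ?_
      refine sum_le_sum fun y _ => ?_
      have := mul_le_mul_of_nonneg_left (one_b hp0 hp (f (Fin.cons true y)) (f (Fin.cons false y)))
        (kp_nonneg _ (K_nonneg hp0 hp) s y)
      refine this.trans (le_of_eq ?_)
      change _ = 2 * (p * (1 - p)) * kp (K p) s y * _ + 2 * (p * (1 - p)) * kp (K p) s y * _
      ring

noncomputable def F {n : ℕ} (p : ℝ) (c : (Fin n → Bool) → ℝ) (x : Fin n → Bool) : ℝ :=
  ∑ t, c t * kp (ck p) t x

noncomputable def L {n : ℕ} (s : Fin n → Bool) (c : (Fin n → Bool) → ℝ) : ℝ :=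
  ∑ t, kp kap s t * c t ^ 2

lemma F_cons {p : ℝ} {n : ℕ} (c : (Fin (n+1) → Bool) → ℝ) (b : Bool) (y : Fin n → Bool) :
    F p c (Fin.cons b y : Fin (n+1) → Bool) =
      F p (fun t => c (Fin.cons false t)) y + ph p b * F p (fun t => c (Fin.cons true t)) y := by
  unfold F
  rw [sum_cons, mul_sum, ← sum_add_distrib]
  refine sum_congr rfl fun t _ => ?_
  simp only [kp_cons, ck, if_true, Bool.false_eq_true, if_false]
  ring

lemma L_cons_true {n : ℕ} (c : (Fin (n+1) → Bool) → ℝ) (s : Fin n → Bool) :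
    L (Fin.cons true s : Fin (n+1) → Bool) c = 4 * L s (fun t => c (Fin.cons true t)) := by
  unfold L
  rw [sum_cons, mul_sum]
  refine sum_congr rfl fun t _ => ?_
  simp only [kp_cons, kap, if_true, Bool.false_eq_true, if_false]
  ring

lemma L_cons_false {n : ℕ} (c : (Fin (n+1) → Bool) → ℝ) (s : Fin n → Bool) :
    L (Fin.cons false s : Fin (n+1) → Bool) c = L s (fun t => c (Fin.cons false t))
      + 4 * L s (fun t => c (Fin.cons true t)) := by
  unfold L
  rw [sum_cons, mul_sum, ← sum_add_distrib]
  refine sum_congr rfl fun t _ => ?_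
  simp only [kp_cons, kap, if_true, Bool.false_eq_true, if_false]
  ring

lemma kap_nonneg (a b : Bool) : 0 ≤ kap a b := by
  cases a <;> cases b <;> simp [kap]

lemma L_nonneg {n : ℕ} (s : Fin n → Bool) (c : (Fin n → Bool) → ℝ) : 0 ≤ L s c :=
  sum_nonneg fun _ _ => mul_nonneg (kp_nonneg _ kap_nonneg _ _) (sq_nonneg _)

lemma hyper {p : ℝ} (hp0 : 0 < p) (hp : p ≤ 1 / 2) {n : ℕ} : ∀ (c e : (Fin n → Bool) → ℝ),
    ∑ x, w1 (wb p) x * (F p c x ^ 2 * F p e x ^ 2)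
      ≤ ∑ s, w1 (tw (3 / 16 / (p * (1 - p)))) s * (L s c * L s e) := by
  have hs := sg_pos hp0 hp
  induction n with
  | zero =>
    intro c e
    simp [w1, F, L, kp]
  | succ n ih =>
    intro c e
    rw [sum_cons, sum_cons]
    simp only [w1_cons, F_cons, L_cons_true, L_cons_false]
    set c0 := fun t => c (Fin.cons false t)
    set c1 := fun t => c (Fin.cons true t)
    set e0 := fun t => e (Fin.cons false t)
    set e1 := fun t => e (Fin.cons true t)
    calc _ ≤ ∑ y : Fin n → Bool, (w1 (wb p) y * (F p c0 y ^ 2 * F p e0 y ^ 2)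
              + 4 * (w1 (wb p) y * (F p c0 y ^ 2 * F p e1 y ^ 2))
              + 4 * (w1 (wb p) y * (F p c1 y ^ 2 * F p e0 y ^ 2))
              + 3 / (p * (1 - p)) * (w1 (wb p) y * (F p c1 y ^ 2 * F p e1 y ^ 2))) := by
          refine sum_le_sum fun y _ => ?_
          have := mul_le_mul_of_nonneg_left (one_c hp0 hp (F p c0 y) (F p c1 y) (F p e0 y) (F p e1 y))
            (w1_nonneg _ (wb_nonneg hp0 hp) y)
          have h1 : wb p true = p := by simp [wb]
          have h2 : wb p false = 1 - p := by simp [wb]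
          rw [h1, h2]
          linarith
      _ ≤ ∑ s : Fin n → Bool, (w1 (tw (3 / 16 / (p * (1 - p)))) s * (L s c0 * L s e0)
              + 4 * (w1 (tw (3 / 16 / (p * (1 - p)))) s * (L s c0 * L s e1))
              + 4 * (w1 (tw (3 / 16 / (p * (1 - p)))) s * (L s c1 * L s e0))
              + 3 / (p * (1 - p)) * (w1 (tw (3 / 16 / (p * (1 - p)))) s * (L s c1 * L s e1))) := by
          simp only [sum_add_distrib, ← mul_sum]
          have := ih c0 e0
          have := ih c0 e1
          have := ih c1 e0
          have := mul_le_mul_of_nonneg_left (ih c1 e1) (show 0 ≤ 3 / (p * (1 - p)) by positivity)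
          linarith
      _ ≤ _ := by
          refine sum_le_sum fun s _ => ?_
          have hw : 0 ≤ w1 (tw (3 / 16 / (p * (1 - p)))) s := w1_nonneg _ (fun a => by
            cases a <;> simp only [tw] <;> simp <;> positivity) s
          have h1 : tw (3 / 16 / (p * (1 - p))) true = 3 / 16 / (p * (1 - p)) := by simp [tw]
          have h2 : tw (3 / 16 / (p * (1 - p))) false = 1 := by simp [tw]
          rw [h1, h2]
          have := mul_nonneg hw (mul_nonneg (L_nonneg s c1) (L_nonneg s e1))
          have e3 : 3 / (p * (1 - p)) = 16 * (3 / 16 / (p * (1 - p))) := by ring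
          rw [e3]
          generalize 3 / 16 / (p * (1 - p)) = q at *
          nlinarith
lemma restrict_eq {n : ℕ} (p : ℝ) (J : Finset (Fin n)) (f : (Fin n → Bool) → ℝ) :
    cubeE p (cubeRestrict J J f) =
      ∑ x : Fin n → Bool, (∏ i, if i ∈ J then (if x i then 1 else 0) else wb p (x i)) * f x := by
  unfold cubeE cubeRestrict cubeWt
  have key : ∀ x : Fin n → Bool, (∏ i, if i ∈ J then (if x i then (1 : ℝ) else 0) else wb p (x i))
      = ∑ y : Fin n → Bool, ∏ i, (wb p (y i) *
        if x i = (if i ∈ J then decide (i ∈ J) else y i) then 1 else 0) := by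
    intro x
    rw [sum_prod (fun i b => wb p b * if x i = (if i ∈ J then decide (i ∈ J) else b) then 1 else 0)]
    refine prod_congr rfl fun i _ => ?_
    by_cases hi : i ∈ J <;> cases hx : x i <;> simp [hi, wb]
  simp only [key, sum_mul]
  rw [sum_comm]
  refine sum_congr rfl fun y _ => ?_
  simp only [prod_mul_distrib]
  rw [sum_eq_single (fun i => if i ∈ J then decide (i ∈ J) else y i)]
  · simp [wb]
  · intro x _ hx
    obtain ⟨i, hi⟩ := Function.ne_iff.1 hx
    rw [prod_eq_zero (i := i) (f := fun i => if x i = (if i ∈ J then decide (i ∈ J) else y i) then (1:ℝ) else 0) (mem_univ i) (if_neg hi)]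
    simp
  · simp

lemma glob {n : ℕ} {p : ℝ} (hp0 : 0 < p) (hp : p ≤ 1 / 2) (f : (Fin n → Bool) → ℝ)
    (hf : ∀ x, 0 ≤ f x) (γ : ℝ) (s : Fin n → Bool)
    (hg : ∀ J : Finset (Fin n), J ⊆ univ.filter (fun i => s i = true) →
      cubeE p (cubeRestrict J J f) ≤ γ) :
    ∑ x, kp (K p) s x * f x ≤ w1 (tw (6 * (p * (1 - p)))) s * γ := by
  have hs := sg_pos hp0 hp
  set σ := p * (1 - p) with hσ
  have hwb := wb_nonneg hp0 hp
  -- pointwise bound of the kernel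
  have h1 : ∀ x : Fin n → Bool, kp (K p) s x ≤ ∏ i, ((if s i then 2 * σ * (if x i then 1 else 0) else 0)
      + (if s i then 4 * σ * wb p (x i) else wb p (x i))) := by
    intro x
    refine prod_le_prod (fun i _ => K_nonneg hp0 hp _ _) fun i _ => ?_
    cases s i <;> cases x i <;> simp [K, wb, ← hσ] <;> nlinarith
  have h2 : ∀ x : Fin n → Bool, ∏ i, ((if s i then 2 * σ * (if x i then 1 else 0) else 0)
      + (if s i then 4 * σ * wb p (x i) else wb p (x i))) =
      ∑ J ∈ (univ : Finset (Fin n)).powerset, ((∏ i, if i ∈ J then (if s i then 2 * σ else 0)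
        else (if s i then 4 * σ else 1)) *
        ∏ i, if i ∈ J then (if x i then 1 else 0) else wb p (x i)) := by
    intro x
    rw [prod_add]
    refine sum_congr rfl fun J _ => ?_
    rw [← prod_mul_distrib, ← prod_sdiff (subset_univ J), mul_comm]
    congr 1
    · refine prod_congr rfl fun i hi => ?_
      have hi' : i ∉ J := (mem_sdiff.1 hi).2
      simp only [hi', if_false]
      split_ifs <;> ring
    · refine prod_congr rfl fun i hi => ?_
      simp only [hi, if_true]
      split_ifs <;> ring
  calc _ ≤ ∑ x, (∑ J ∈ (univ : Finset (Fin n)).powerset, ((∏ i, if i ∈ J then (if s i then 2 * σ else 0)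
        else (if s i then 4 * σ else 1)) *
        ∏ i, if i ∈ J then (if x i then 1 else 0) else wb p (x i))) * f x := by
        refine sum_le_sum fun x _ => mul_le_mul_of_nonneg_right ((h1 x).trans (h2 x).le) (hf x)
    _ = ∑ J ∈ (univ : Finset (Fin n)).powerset, (∏ i, if i ∈ J then (if s i then 2 * σ else 0)
        else (if s i then 4 * σ else 1)) * cubeE p (cubeRestrict J J f) := by
        simp only [sum_mul]
        rw [sum_comm]
        refine sum_congr rfl fun J _ => ?_
        rw [restrict_eq, mul_sum]
        refine sum_congr rfl fun x _ => by ring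
    _ ≤ ∑ J ∈ (univ : Finset (Fin n)).powerset, (∏ i, if i ∈ J then (if s i then 2 * σ else 0)
        else (if s i then 4 * σ else 1)) * γ := by
        refine sum_le_sum fun J _ => ?_
        by_cases hJ : J ⊆ univ.filter (fun i => s i = true)
        · refine mul_le_mul_of_nonneg_left (hg J hJ) (prod_nonneg fun i _ => ?_)
          split_ifs <;> positivity
        · obtain ⟨i, hi, hi2⟩ := not_subset.1 hJ
          have hi3 : s i = false := by simpa using hi2
          rw [prod_eq_zero (mem_univ i) (by simp [hi, hi3])]
          simp
    _ = _ := by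
        rw [← sum_mul]
        congr 1
        have := prod_add (fun i => if s i then 2 * σ else 0) (fun i => if s i then 4 * σ else 1)
          (univ : Finset (Fin n))
        have e : w1 (tw (6 * σ)) s = ∏ i, ((if s i then 2 * σ else 0) + (if s i then 4 * σ else 1)) := by
          refine prod_congr rfl fun i _ => ?_
          cases s i <;> simp [tw]; ring
        rw [e, this]
        refine sum_congr rfl fun J _ => ?_
        rw [← prod_sdiff (subset_univ J), mul_comm]
        congr 1
        · refine prod_congr rfl fun i hi => ?_
          simp [hi]
        · refine prod_congr rfl fun i hi => ?_
          simp [(mem_sdiff.1 hi).2]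

/-- number of ones -/
def nb {n : ℕ} (s : Fin n → Bool) : ℕ := (univ.filter (fun i => s i = true)).card

lemma w1_tw {n : ℕ} (c : ℝ) (s : Fin n → Bool) : w1 (tw c) s = c ^ nb s := by
  unfold w1 tw nb
  rw [prod_ite]; simp

lemma kap_eq {n : ℕ} (s t : Fin n → Bool) : kp kap s t = 4 ^ nb t * kp lek s t := by
  rw [← w1_tw, w1, kp, kp, ← prod_mul_distrib]
  refine prod_congr rfl fun i _ => ?_
  cases s i <;> cases t i <;> simp [kap, tw, lek]

lemma lek_nonneg (a b : Bool) : 0 ≤ lek a b := by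
  cases a <;> cases b <;> simp [lek]

lemma kp_lek_zero {n : ℕ} (s t : Fin n → Bool) (h : kp lek s t ≠ 0) : nb s ≤ nb t := by
  refine card_le_card fun i hi => ?_
  simp only [mem_filter, mem_univ, true_and] at hi ⊢
  by_contra ht
  apply h
  refine prod_eq_zero (mem_univ i) ?_
  simp [hi, ht, lek]

lemma four {n : ℕ} {p : ℝ} (hp0 : 0 < p) (hp : p ≤ 1 / 2) (f : (Fin n → Bool) → ℝ)
    (hB : ∀ x, f x = 0 ∨ f x = 1) (d : ℕ) (γ : ℝ) (hγ : 0 ≤ γ)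
    (hg : ∀ J : Finset (Fin n), J.card ≤ d → cubeE p (cubeRestrict J J f) ≤ γ)
    (c : (Fin n → Bool) → ℝ) (hc : c = fun t => if nb t ≤ d then fh p f t else 0) :
    ∑ x, w1 (wb p) x * F p c x ^ 4 ≤ 34 ^ d * γ * ∑ t, c t ^ 2 := by
  have hs := sg_pos hp0 hp
  have hf : ∀ x, 0 ≤ f x := fun x => by rcases hB x with h | h <;> simp [h]
  have hf2 : ∀ x, f x ^ 2 = f x := fun x => by rcases hB x with h | h <;> simp [h]
  set σ := p * (1 - p) with hσ
  -- influence bound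
  have hL : ∀ s, L s c ≤ 4 ^ d * ((6 * σ) ^ nb s * γ) := by
    intro s
    by_cases hsd : nb s ≤ d
    · have h1 := (bessel hp0 hp f s)
      simp only [hf2] at h1
      have h2 := glob hp0 hp f hf γ s (fun J hJ => hg J ((card_le_card hJ).trans hsd))
      rw [w1_tw] at h2
      refine le_trans ?_ (mul_le_mul_of_nonneg_left (h1.trans h2) (by positivity))
      rw [mul_sum]
      refine sum_le_sum fun t _ => ?_
      rw [kap_eq, hc]
      have := kp_nonneg _ lek_nonneg s t
      dsimp only
      split_ifs with ht
      · rw [mul_assoc]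
        gcongr
        norm_num
      · simp; positivity
    · have : L s c = 0 := by
        refine sum_eq_zero fun t _ => ?_
        rw [kap_eq, hc]
        dsimp only
        split_ifs with ht
        · have : kp lek s t = 0 := by
            by_contra h
            exact hsd ((kp_lek_zero s t h).trans ht)
          simp [this]
        · simp
      rw [this]; positivity
  have h0 := hyper hp0 hp c c
  rw [← hσ] at h0
  calc ∑ x, w1 (wb p) x * F p c x ^ 4 = ∑ x, w1 (wb p) x * (F p c x ^ 2 * F p c x ^ 2) :=
        sum_congr rfl fun x _ => by ring
    _ ≤ _ := h0
    _ ≤ ∑ s, 4 ^ d * γ * (w1 (tw (9/8)) s * L s c) := by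
        refine sum_le_sum fun s _ => ?_
        rw [w1_tw, w1_tw]
        have := mul_le_mul_of_nonneg_right (hL s) (L_nonneg s c)
        have := mul_le_mul_of_nonneg_left this (show 0 ≤ (3 / 16 / σ) ^ nb s by positivity)
        refine this.trans (le_of_eq ?_)
        have e : (9/8 : ℝ) = (3 / 16 / σ) * (6 * σ) := by field_simp; norm_num
        rw [e, mul_pow (3 / 16 / σ)]
        ring
    _ = 4 ^ d * γ * ∑ t, (17/2) ^ nb t * c t ^ 2 := by
        rw [← mul_sum]
        congr 1
        simp only [L, mul_sum]
        rw [sum_comm]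
        refine sum_congr rfl fun t _ => ?_
        simp only [← mul_assoc]
        rw [← sum_mul]
        congr 1
        simp only [w1, kp, ← prod_mul_distrib]
        rw [sum_prod (fun i a => tw (9/8) a * kap a (t i)), ← w1_tw, w1]
        refine prod_congr rfl fun i _ => ?_
        cases t i <;> simp [tw, kap]; norm_num
    _ ≤ 4 ^ d * γ * ∑ t, (17/2) ^ d * c t ^ 2 := by
        refine mul_le_mul_of_nonneg_left (sum_le_sum fun t _ => ?_) (by positivity)
        by_cases ht : nb t ≤ d
        · gcongr; norm_num
        · simp [hc, ht]
    _ = _ := by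
        rw [← mul_sum]
        have : (34 : ℝ) ^ d = 4 ^ d * (17/2) ^ d := by rw [← mul_pow]; norm_num
        rw [this]; ring

lemma level {n : ℕ} {p : ℝ} (hp0 : 0 < p) (hp : p ≤ 1 / 2) (f : (Fin n → Bool) → ℝ)
    (hB : ∀ x, f x = 0 ∨ f x = 1) (d : ℕ) (γ : ℝ) (hγ : 0 ≤ γ)
    (hg : ∀ J : Finset (Fin n), J.card ≤ d → cubeE p (cubeRestrict J J f) ≤ γ)
    (c : (Fin n → Bool) → ℝ) (hc : c = fun t => if nb t ≤ d then fh p f t else 0) :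
    (∑ t, c t ^ 2) ^ 3 ≤ 34 ^ d * γ * (∑ x, w1 (wb p) x * f x) ^ 3 := by
  have hf : ∀ x, 0 ≤ f x := fun x => by rcases hB x with h | h <;> simp [h]
  have hf2 : ∀ x, f x ^ 2 = f x := fun x => by rcases hB x with h | h <;> simp [h]
  have hw := w1_nonneg (n := n) _ (wb_nonneg hp0 hp)
  have h4 := four hp0 hp f hB d γ hγ hg c hc
  set X := ∑ t, c t ^ 2 with hX
  set μ := ∑ x, w1 (wb p) x * f x with hμ
  have hX0 : 0 ≤ X := sum_nonneg fun _ _ => sq_nonneg _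
  have hμ0 : 0 ≤ μ := sum_nonneg fun x _ => mul_nonneg (hw x) (hf x)
  have e1 : X = ∑ x, w1 (wb p) x * (f x * F p c x) := by
    have : ∀ t, c t ^ 2 = c t * fh p f t := by
      intro t; rw [hc]; dsimp only; split_ifs
      · ring
      · simp
    rw [hX]
    simp only [this, fh, F, mul_sum]
    rw [sum_comm]
    refine sum_congr rfl fun x _ => sum_congr rfl fun t _ => by ring
  set Y := ∑ x, w1 (wb p) x * (f x * F p c x ^ 2) with hY
  have c1 : X ^ 2 ≤ μ * Y := by
    rw [e1]
    refine sum_sq_le_sum_mul_sum_of_sq_le_mul univ (fun x _ => mul_nonneg (hw x) (hf x))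
      (fun x _ => mul_nonneg (hw x) (mul_nonneg (hf x) (sq_nonneg _))) (fun x _ => le_of_eq ?_)
    ring
  have c2 : Y ^ 2 ≤ μ * ∑ x, w1 (wb p) x * F p c x ^ 4 := by
    refine sum_sq_le_sum_mul_sum_of_sq_le_mul univ (fun x _ => mul_nonneg (hw x) (hf x))
      (fun x _ => mul_nonneg (hw x) (by positivity)) (fun x _ => le_of_eq ?_)
    have := hf2 x
    linear_combination (w1 (wb p) x ^ 2 * F p c x ^ 4) * this
  have c3 : X ^ 4 ≤ μ ^ 3 * (34 ^ d * γ * X) := by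
    calc X ^ 4 = (X ^ 2) ^ 2 := by ring
      _ ≤ (μ * Y) ^ 2 := by gcongr
      _ = μ ^ 2 * Y ^ 2 := by ring
      _ ≤ μ ^ 2 * (μ * (34 ^ d * γ * X)) := by
        refine mul_le_mul_of_nonneg_left (c2.trans ?_) (by positivity)
        exact mul_le_mul_of_nonneg_left h4 hμ0
      _ = _ := by ring
  rcases hX0.eq_or_lt with h | h
  · rw [← h]; simp; positivity
  · refine le_of_mul_le_mul_right (a := X) ?_ h
    linarith

lemma parseval {n : ℕ} {p : ℝ} (hp0 : 0 < p) (hp : p ≤ 1 / 2) (f : (Fin n → Bool) → ℝ)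
    (hB : ∀ x, f x = 0 ∨ f x = 1) :
    ∑ t, fh p f t ^ 2 ≤ ∑ x, w1 (wb p) x * f x := by
  have hf2 : ∀ x, f x ^ 2 = f x := fun x => by rcases hB x with h | h <;> simp [h]
  have h := bessel hp0 hp f (fun _ => false)
  simp only [hf2] at h
  simpa [kp, lek, K, w1] using h

lemma cubeE_eq {n : ℕ} (p : ℝ) (f : (Fin n → Bool) → ℝ) :
    cubeE p f = ∑ x, w1 (wb p) x * f x := rfl

lemma fhat_eq {n : ℕ} (p : ℝ) (f : (Fin n → Bool) → ℝ) (t : Fin n → Bool) :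
    fhat p f (univ.filter (fun i => t i = true)) = fh p f t := by
  unfold fhat fh
  rw [cubeE_eq]
  refine sum_congr rfl fun x _ => ?_
  have : chi p (univ.filter (fun i => t i = true)) x = kp (ck p) t x := by
    unfold chi kp ck
    rw [prod_filter]; rfl
  rw [this]; ring

lemma sum_fs {n : ℕ} (G : Finset (Fin n) → ℝ) :
    ∑ S, G S = ∑ t : Fin n → Bool, G (univ.filter (fun i => t i = true)) := by
  symm
  refine Fintype.sum_bijective (fun t : Fin n → Bool => univ.filter (fun i => t i = true)) ?_ _ _
    (fun _ => rfl)
  constructor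
  · intro s t h
    funext i
    have := congrArg (fun S => i ∈ S) h
    simp at this
    cases hs : s i <;> cases ht : t i <;> simp_all
  · intro S
    exact ⟨fun i => decide (i ∈ S), by ext; simp⟩

end GH

open GH

theorem stmt12 {n : ℕ} (p ρ ε : ℝ) (hp0 : 0 < p) (hp : p ≤ 1 / 2)
    (hρ0 : 0 < ρ) (hρ1 : ρ < 1) (hε : 0 < ε)
    (f : (Fin n → Bool) → ℝ) (hBool : ∀ x, f x = 0 ∨ f x = 1)
    (r δ : ℝ) (hr : r = Real.log (2 / ε) / Real.log (1 / ρ))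
    (hδ : δ = (10 : ℝ) ^ (-(3 * r) - 1) * ε ^ 3)
    (hglob : ∀ J : Finset (Fin n), (J.card : ℝ) ≤ r →
      cubeE p (cubeRestrict J J f) ≤ cubeE p f + δ)
    (hsparse : cubeE p f < δ) :
    ∑ S : Finset (Fin n), ρ ^ S.card * (fhat p f S) ^ 2 ≤ ε * cubeE p f := by
  rw [sum_fs]
  simp only [fhat_eq]
  change ∑ t : Fin n → Bool, ρ ^ nb t * fh p f t ^ 2 ≤ _
  have hf : ∀ x, 0 ≤ f x := fun x => by rcases hBool x with h | h <;> simp [h]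
  have hpar := parseval hp0 hp f hBool
  rw [← cubeE_eq] at hpar
  have hμ0 : 0 ≤ cubeE p f := (sum_nonneg fun _ _ => sq_nonneg _).trans hpar
  by_cases hε1 : 1 ≤ ε
  · calc _ ≤ ∑ t : Fin n → Bool, fh p f t ^ 2 := by
          refine sum_le_sum fun t _ => ?_
          have : ρ ^ nb t ≤ 1 := pow_le_one₀ hρ0.le hρ1.le
          nlinarith [sq_nonneg (fh p f t)]
      _ ≤ cubeE p f := hpar
      _ ≤ _ := by nlinarith
  push Not at hε1
  have hlρ : 0 < Real.log (1 / ρ) := Real.log_pos (by rw [lt_div_iff₀ hρ0]; linarith)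
  have hr0 : 0 < r := by
    rw [hr]
    exact div_pos (Real.log_pos (by rw [lt_div_iff₀ hε]; linarith)) hlρ
  have hρr : ρ ^ r = ε / 2 := by
    rw [Real.rpow_def_of_pos hρ0]
    have : Real.log ρ * r = Real.log (ε / 2) := by
      rw [hr]
      have h1 : Real.log (1 / ρ) = - Real.log ρ := by rw [one_div, Real.log_inv]
      have h2 : Real.log (2 / ε) = - Real.log (ε / 2) := by rw [← Real.log_inv, inv_div]
      have h3 : Real.log ρ ≠ 0 := by intro h; rw [h1, h] at hlρ; simp at hlρ
      rw [h1, h2]; field_simp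
    rw [this, Real.exp_log (by positivity)]
  have hδ0 : 0 < δ := by rw [hδ]; positivity
  set d := ⌊r⌋₊ with hd
  have hdr : (d : ℝ) ≤ r := Nat.floor_le hr0.le
  -- level inequality
  obtain ⟨γ, hγ0, hγg, hγ⟩ : ∃ γ : ℝ, 0 ≤ γ ∧
      (∀ J : Finset (Fin n), J.card ≤ d → cubeE p (cubeRestrict J J f) ≤ γ) ∧
      34 ^ d * γ ≤ (ε / 2) ^ 3 := by
    have hδ2 : 1000 ^ d * δ ≤ ε ^ 3 / 10 := by
      have e1 : (10 : ℝ) ^ (-(3 * r) - 1) = (1000 ^ r)⁻¹ / 10 := by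
        rw [Real.rpow_sub (by norm_num), Real.rpow_neg (by norm_num), Real.rpow_mul (by norm_num)]
        norm_num
      have e2 : (1000 : ℝ) ^ d ≤ 1000 ^ r := by
        rw [← Real.rpow_natCast]
        exact Real.rpow_le_rpow_of_exponent_le (by norm_num) hdr
      have e3 : (0 : ℝ) < 1000 ^ r := by positivity
      rw [hδ, e1]
      calc (1000 : ℝ) ^ d * ((1000 ^ r)⁻¹ / 10 * ε ^ 3)
          ≤ 1000 ^ r * ((1000 ^ r)⁻¹ / 10 * ε ^ 3) := by gcongr
        _ = _ := by field_simp
    have hε3 : 0 < ε ^ 3 := by positivity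
    rcases Nat.eq_zero_or_pos d with h0 | h0
    · refine ⟨δ, hδ0.le, fun J hJ => ?_, ?_⟩
      · have : J = ∅ := by rw [h0] at hJ; simpa using hJ
        subst this
        have : cubeRestrict ∅ ∅ f = f := by funext y; simp [cubeRestrict]
        rw [this]; exact hsparse.le
      · rw [h0] at hδ2 ⊢
        simp only [pow_zero, one_mul] at hδ2 ⊢
        linarith [div_pow ε 2 3]
    · refine ⟨2 * δ, by positivity, fun J hJ => ?_, ?_⟩
      · have := hglob J (le_trans (by exact_mod_cast hJ) hdr)
        linarith
      · obtain ⟨k, hk⟩ : ∃ k, d = k + 1 := ⟨d - 1, by omega⟩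
        rw [hk] at hδ2 ⊢
        have : (34 : ℝ) ^ k ≤ 1000 ^ k := by gcongr; norm_num
        have := mul_le_mul_of_nonneg_right this hδ0.le
        rw [pow_succ] at hδ2 ⊢
        have e : (ε / 2) ^ 3 = ε ^ 3 / 8 := by ring
        rw [e]
        nlinarith
  have hlev := level hp0 hp f hBool d γ hγ0 hγg _ rfl
  rw [← cubeE_eq] at hlev
  set X := ∑ t : Fin n → Bool, (if nb t ≤ d then fh p f t else 0) ^ 2 with hX
  have hX2 : X ≤ ε / 2 * cubeE p f := by
    refine le_of_pow_le_pow_left₀ (n := 3) (by norm_num) (by positivity) ?_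
    rw [mul_pow]
    exact hlev.trans (mul_le_mul_of_nonneg_right hγ (by positivity))
  calc _ ≤ ∑ t : Fin n → Bool, ((if nb t ≤ d then fh p f t else 0) ^ 2 + ε / 2 * fh p f t ^ 2) := by
        refine sum_le_sum fun t _ => ?_
        have h2 := sq_nonneg (fh p f t)
        split_ifs with ht
        · have : ρ ^ nb t ≤ 1 := pow_le_one₀ hρ0.le hρ1.le
          nlinarith
        · have h3 : r < nb t := (Nat.floor_lt hr0.le).1 (not_le.1 ht)
          have : ρ ^ nb t ≤ ε / 2 := by
            rw [← hρr, ← Real.rpow_natCast]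
            exact Real.rpow_le_rpow_of_exponent_ge hρ0 hρ1.le h3.le
          nlinarith
    _ = X + ε / 2 * ∑ t, fh p f t ^ 2 := by rw [sum_add_distrib, mul_sum]
    _ ≤ _ := by nlinarith
end

section
/- Let $m\le s$ and $p_1,\ldots,p_s>0$ with $\sum_{i\in[s]}p_i\le 1/2$. Suppose $\mathcal{F}_1,\ldots,\mathcal{F}_s\subset\{0,1\}^n$ are monotone families with $\mu_{p_i}(\mathcal{F}_i)\ge 3mp_i$ for $i\in[m]$ and $\mu_{p_i}(\mathcal{F}_i)\ge 3sp_i$ for $i\in[m+1,s]$. Then $\mathcal{F}_1,\ldots,\mathcal{F}_s$ cross contain a matching: there are pairwise disjoint sets $A_1,\ldots,A_s$ with $A_i\in\mathcal{F}_i$ for all $i$. -/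
open Finset

/-- `DD n k` is the number of `k`-subsets of an `n`-set containing a fixed element. -/
def DD : ℕ → ℕ → ℕ
  | n + 1, k + 1 => Nat.choose n k
  | _, _ => 0

theorem DD_zero_right (n : ℕ) : DD n 0 = 0 := by cases n <;> rfl

theorem DD_zero_left (n : ℕ) : DD 0 n = 0 := by cases n <;> rfl

theorem DD_rec (n k : ℕ) : DD n (k + 1) + DD n k ≤ DD (n + 1) (k + 1) := by
  cases n with
  | zero => simp [DD_zero_left]
  | succ n =>
    cases k with
    | zero => simp [DD]
    | succ k => simp only [DD]; rw [Nat.choose_succ_succ']; omega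

theorem DD_bound (n k : ℕ) (c : ℝ) (hc : 0 < c) (h : c * DD n k < Nat.choose n k) :
    (k : ℝ) ≤ n * c⁻¹ := by
  cases k with
  | zero => simp; positivity
  | succ k =>
    cases n with
    | zero => simp [DD] at h
    | succ n =>
      simp only [DD] at h
      have h1 : ((n + 1 : ℕ) : ℝ) * Nat.choose n k = Nat.choose (n + 1) (k + 1) * (k + 1 : ℕ) := by
        exact_mod_cast Nat.add_one_mul_choose_eq n k
      have hpos : (0 : ℝ) < Nat.choose (n + 1) (k + 1) :=
        lt_of_le_of_lt (by positivity) h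
      have hk : (0 : ℝ) < ((k + 1 : ℕ) : ℝ) := by positivity
      have h2 : c * ((k + 1 : ℕ) : ℝ) * Nat.choose (n + 1) (k + 1)
          ≤ ((n + 1 : ℕ) : ℝ) * Nat.choose (n + 1) (k + 1) := by
        have := mul_le_mul_of_nonneg_left h.le (Nat.cast_nonneg (α := ℝ) (n + 1))
        calc _ = ((n + 1 : ℕ) : ℝ) * (c * Nat.choose n k) := by
              rw [mul_assoc, mul_comm ((k + 1 : ℕ) : ℝ), ← h1]; ring
          _ ≤ _ := this
      have h3 := le_of_mul_le_mul_right h2 hpos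
      rw [← div_eq_mul_inv, le_div_iff₀ hc]
      linarith

section
variable {α ι : Type*} [DecidableEq α] [Fintype ι] [DecidableEq ι]

/-- cross containing a matching -/
def CrossM (F : ι → Finset (Finset α)) : Prop :=
  ∃ A : ι → Finset α, (∀ i, A i ∈ F i) ∧ ∀ i j, i ≠ j → Disjoint (A i) (A j)

/-- shift `a → x` -/
def shf (x a : α) (F : Finset (Finset α)) : Finset (Finset α) := UV.compression {x} {a} F

theorem mem_shf {x a : α} (hxa : x ≠ a) {F : Finset (Finset α)} {B : Finset α} :
    B ∈ shf x a F ↔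
      (B ∈ F ∧ (a ∈ B → x ∉ B → insert x (B.erase a) ∈ F)) ∨
      (B ∉ F ∧ x ∈ B ∧ a ∉ B ∧ insert a (B.erase x) ∈ F) := by
  have hc : ∀ C : Finset α, UV.compress {x} {a} C =
      if a ∈ C ∧ x ∉ C then insert x (C.erase a) else C := by
    intro C
    unfold UV.compress
    simp only [Finset.disjoint_singleton_left, Finset.singleton_subset_iff]
    by_cases h : a ∈ C ∧ x ∉ C
    · rw [if_pos h, if_pos ⟨h.2, h.1⟩]
      ext y; simp only [Finset.sup_eq_union, mem_sdiff, mem_union, mem_singleton, mem_insert, mem_erase]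
      grind
    · rw [if_neg h, if_neg (fun h' => h ⟨h'.2, h'.1⟩)]
  unfold shf
  rw [UV.mem_compression]
  apply or_congr
  · apply and_congr_right
    intro hB
    rw [hc]
    split_ifs with h
    · grind
    · grind
  · apply and_congr_right
    intro hB
    constructor
    · rintro ⟨C, hC, hCB⟩
      rw [hc] at hCB
      split_ifs at hCB with h
      · subst hCB
        refine ⟨by simp, by simp [hxa.symm], ?_⟩
        have : insert a ((insert x (C.erase a)).erase x) = C := by
          ext y; simp only [mem_insert, mem_erase]; grind
        rwa [this]
      · subst hCB; exact absurd hC hB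
    · rintro ⟨h1, h2, h3⟩
      refine ⟨_, h3, ?_⟩
      rw [hc, if_pos]
      · ext y; simp only [mem_insert, mem_erase]; grind
      · simp [hxa]

theorem crossM_of_shf {x a : α} (hxa : x ≠ a) {F : ι → Finset (Finset α)}
    (h : CrossM (fun i => shf x a (F i))) : CrossM F := by
  obtain ⟨A, hA, hd⟩ := h
  simp only [mem_shf hxa] at hA
  by_cases hall : ∀ i, A i ∈ F i
  · exact ⟨A, hall, hd⟩
  push Not at hall
  obtain ⟨i, hi⟩ := hall
  have hi' := (hA i).resolve_left (fun h => hi h.1)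
  have hx : ∀ j, j ≠ i → x ∉ A j := fun j hj hxj =>
    Finset.disjoint_left.1 (hd j i hj) hxj hi'.2.1
  refine ⟨fun j => (A j).map (Equiv.swap x a).toEmbedding, ?_, ?_⟩
  · intro j
    by_cases hj : j = i
    · subst hj
      have : (A j).map (Equiv.swap x a).toEmbedding = insert a ((A j).erase x) := by
        ext y
        simp only [mem_map_equiv, Equiv.symm_swap, mem_insert, mem_erase]
        rw [Equiv.swap_apply_def]
        grind
      simp only [this]
      exact hi'.2.2.2
    · have hxj := hx j hj
      have hF := (hA j).resolve_right (fun h => hxj h.2.1)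
      by_cases haj : a ∈ A j
      · have : (A j).map (Equiv.swap x a).toEmbedding = insert x ((A j).erase a) := by
          ext y
          simp only [mem_map_equiv, Equiv.symm_swap, mem_insert, mem_erase]
          rw [Equiv.swap_apply_def]
          grind
        simp only [this]
        exact hF.2 haj hxj
      · have : (A j).map (Equiv.swap x a).toEmbedding = A j := by
          ext y
          simp only [mem_map_equiv, Equiv.symm_swap]
          rw [Equiv.swap_apply_def]
          grind
        simp only [this]
        exact hF.1
  · intro j k hjk
    exact (Finset.disjoint_map _).2 (hd j k hjk)

theorem shf_subset {x a : α} (hxa : x ≠ a) {F : Finset (Finset α)} {V : Finset α} {k : ℕ}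
    (hx : x ∈ V) (hF : F ⊆ powersetCard k V) : shf x a F ⊆ powersetCard k V := by
  intro B hB
  rcases (mem_shf hxa).1 hB with h | ⟨-, h1, h2, h3⟩
  · exact hF h.1
  · have := mem_powersetCard.1 (hF h3)
    rw [mem_powersetCard]
    constructor
    · intro y hy
      by_cases hyx : y = x
      · exact hyx ▸ hx
      · exact this.1 (by simp [hyx, hy])
    · rw [← this.2, card_insert_of_notMem (by simp [h2]), card_erase_add_one h1]

theorem shifted_case {V : Finset α} {a : α} (ha : a ∉ V) (c : ι → ℝ) (hc : ∀ i, 0 < c i)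
    (hcs : ∑ i, (c i)⁻¹ ≤ 1)
    (IH : ∀ (k : ι → ℕ) (F : ι → Finset (Finset α)), (∀ i, F i ⊆ powersetCard (k i) V) →
      (∀ i, c i * DD V.card (k i) < (F i).card) → CrossM F)
    (k : ι → ℕ) (F : ι → Finset (Finset α)) (hF : ∀ i, F i ⊆ powersetCard (k i) (insert a V))
    (hcard : ∀ i, c i * DD (insert a V).card (k i) < (F i).card)
    (hsh : ∀ x ∈ V, ∀ i, ∀ B, a ∉ B → x ∉ B → insert a B ∈ F i → insert x B ∈ F i) :
    CrossM F := by
  have hVc : (insert a V).card = V.card + 1 := card_insert_of_notMem ha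
  -- total size
  have hsum : ∑ i, k i ≤ V.card + 1 := by
    have h1 : ∀ i, (k i : ℝ) ≤ (insert a V).card * (c i)⁻¹ := by
      intro i
      apply DD_bound _ _ _ (hc i)
      refine (hcard i).trans_le ?_
      rw [← card_powersetCard]
      exact_mod_cast card_le_card (hF i)
    have h2 : ∑ i, (k i : ℝ) ≤ (insert a V).card * ∑ i, (c i)⁻¹ := by
      rw [mul_sum]; exact sum_le_sum (fun i _ => h1 i)
    have h3 : ((insert a V).card : ℝ) * ∑ i, (c i)⁻¹ ≤ (insert a V).card :=
      mul_le_of_le_one_right (by positivity) hcs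
    have h4 := h2.trans h3
    rw [hVc] at h4
    exact_mod_cast h4
  -- choice
  have hch : ∀ i, ∃ (b : Bool) (k' : ℕ), k' + (if b then 1 else 0) = k i ∧
      c i * DD V.card k' < ((if b then (F i).memberSubfamily a else (F i).nonMemberSubfamily a).card) := by
    intro i
    have hs := card_memberSubfamily_add_card_nonMemberSubfamily a (F i)
    rcases hk : k i with _ | k'
    · refine ⟨false, 0, by simp, ?_⟩
      have hm : (F i).memberSubfamily a = ∅ := by
        rw [eq_empty_iff_forall_notMem]
        intro B hB
        rw [mem_memberSubfamily] at hB
        have := (mem_powersetCard.1 (hF i hB.1)).2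
        rw [hk] at this
        simp at this
      rw [hm, card_empty, zero_add] at hs
      have := hcard i
      simp only [hk, DD_zero_right] at this
      simp [DD_zero_right, hs] at this ⊢
      exact this
    · by_cases h : c i * DD V.card k' < ((F i).memberSubfamily a).card
      · exact ⟨true, k', by simp, by simpa using h⟩
      · refine ⟨false, k' + 1, by simp, ?_⟩
        simp only [Bool.false_eq_true, if_false]
        have h1 := hcard i
        rw [hVc, hk, ← hs] at h1
        push_cast at h1
        have h2 : ((DD V.card (k' + 1) : ℝ) + DD V.card k') ≤ DD (V.card + 1) (k' + 1) := by
          exact_mod_cast DD_rec V.card k'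
        have h3 := mul_le_mul_of_nonneg_left h2 (hc i).le
        rw [mul_add] at h3
        linarith
  choose b k' hk' hb using hch
  obtain ⟨B, hB, hBd⟩ := IH k' _ (by
    intro i
    intro C hC
    by_cases hbi : b i = true
    · simp only [hbi, if_true, mem_memberSubfamily] at hC
      have h1 := mem_powersetCard.1 (hF i hC.1)
      have h2 := hk' i
      rw [hbi, if_pos rfl] at h2
      rw [card_insert_of_notMem hC.2] at h1
      rw [mem_powersetCard]
      exact ⟨(insert_subset_insert_iff hC.2).1 h1.1, by omega⟩
    · simp only [hbi, mem_nonMemberSubfamily] at hC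
      have hC := (mem_nonMemberSubfamily.1 hC)
      have h1 := mem_powersetCard.1 (hF i hC.1)
      have h2 := hk' i
      rw [if_neg hbi] at h2
      rw [mem_powersetCard]
      exact ⟨(subset_insert_iff_of_notMem hC.2).1 h1.1, by omega⟩) hb
  beta_reduce at hB
  have hBa : ∀ i, a ∉ B i := by
    intro i
    have := hB i
    split_ifs at this
    · exact (mem_memberSubfamily.1 this).2
    · exact (mem_nonMemberSubfamily.1 this).2
  have hBk : ∀ i, (B i).card = k' i := by
    intro i
    have h0 := hB i
    have h2 := hk' i
    split_ifs at h0 h2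
    · have h1 := mem_powersetCard.1 (hF i (mem_memberSubfamily.1 h0).1)
      rw [card_insert_of_notMem (hBa i)] at h1
      omega
    · have h1 := mem_powersetCard.1 (hF i (mem_nonMemberSubfamily.1 h0).1)
      omega
  -- free elements
  let W := (insert a V) \ univ.biUnion B
  let S := univ.filter (fun i => b i = true)
  have hSW : S.card ≤ W.card := by
    have h1 : (univ.biUnion B).card ≤ ∑ i, k' i :=
      card_biUnion_le.trans (le_of_eq (sum_congr rfl fun i _ => hBk i))
    have h2 : ∑ i, k i = ∑ i, k' i + S.card := by
      rw [card_filter, ← sum_add_distrib]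
      exact sum_congr rfl fun i _ => (hk' i).symm
    have h3 := le_card_sdiff (univ.biUnion B) (insert a V)
    rw [hVc] at h3
    change S.card ≤ ((insert a V) \ univ.biUnion B).card
    omega
  obtain ⟨e⟩ : Nonempty (S ↪ W) := Function.Embedding.nonempty_of_card_le (by simpa using hSW)
  have heW : ∀ i : S, ∀ j, (e i : α) ∉ B j := by
    intro i j hj
    have := (mem_sdiff.1 (e i).2).2
    exact this (mem_biUnion.2 ⟨j, mem_univ _, hj⟩)
  have hmS : ∀ i, i ∈ S ↔ b i = true := fun i => by simp [S]
  refine ⟨fun i => if h : i ∈ S then insert (e ⟨i, h⟩ : α) (B i) else B i, ?_, ?_⟩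
  · intro i
    have h0 := hB i
    by_cases h : i ∈ S
    · simp only [dif_pos h]
      rw [if_pos ((hmS i).1 h), mem_memberSubfamily] at h0
      rcases mem_insert.1 (mem_sdiff.1 (e ⟨i, h⟩).2).1 with h1 | h1
      · rw [h1]; exact h0.1
      · exact hsh _ h1 i _ h0.2 (heW _ _) h0.1
    · simp only [dif_neg h]
      rw [if_neg (fun hb' => h ((hmS i).2 hb')), mem_nonMemberSubfamily] at h0
      exact h0.1
  · intro i j hij
    have hd := hBd i j hij
    by_cases h : i ∈ S <;> by_cases h' : j ∈ S
    · simp only [dif_pos h, dif_pos h', disjoint_insert_left, disjoint_insert_right, mem_insert,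
        not_or]
      refine ⟨⟨?_, heW _ _⟩, heW _ _, hd⟩
      intro heq
      exact hij (congrArg Subtype.val (e.injective (Subtype.ext heq))).symm
    · simp only [dif_pos h, dif_neg h', disjoint_insert_left]
      exact ⟨heW _ _, hd⟩
    · simp only [dif_neg h, dif_pos h', disjoint_insert_right]
      exact ⟨heW _ _, hd⟩
    · simp only [dif_neg h, dif_neg h']
      exact hd

theorem uniform_case (c : ι → ℝ) (hc : ∀ i, 0 < c i) (hcs : ∑ i, (c i)⁻¹ ≤ 1) (V : Finset α) :
    ∀ (k : ι → ℕ) (F : ι → Finset (Finset α)), (∀ i, F i ⊆ powersetCard (k i) V) →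
      (∀ i, c i * DD V.card (k i) < (F i).card) → CrossM F := by
  induction V using Finset.induction_on with
  | empty =>
    intro k F hF hcard
    refine ⟨fun _ => ∅, ?_, by simp⟩
    intro i
    have h := hcard i
    simp only [card_empty, DD_zero_left] at h
    simp only [Nat.cast_zero, mul_zero, Nat.cast_pos, card_pos] at h
    obtain ⟨B, hB⟩ := h
    have := (mem_powersetCard.1 (hF i hB)).1
    rw [subset_empty] at this
    exact this ▸ hB
  | insert a V ha IH =>
    intro k F
    induction hP : ∑ i, ((F i).filter (fun B => a ∈ B)).card using Nat.strong_induction_on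
      generalizing F with
    | _ P ih =>
    intro hF hcard
    by_cases hsh : ∀ x ∈ V, ∀ i, ∀ B, a ∉ B → x ∉ B → insert a B ∈ F i → insert x B ∈ F i
    · exact shifted_case ha c hc hcs IH k F hF hcard hsh
    · push Not at hsh
      obtain ⟨x, hx, i, B, haB, hxB, h1, h2⟩ := hsh
      have hxa : x ≠ a := fun h => ha (h ▸ hx)
      apply crossM_of_shf hxa
      have hsub : ∀ j, (shf x a (F j)).filter (fun B => a ∈ B) ⊆
          (F j).filter (fun B => a ∈ B) := by
        intro j C hC
        rw [mem_filter, mem_shf hxa] at hC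
        rw [mem_filter]
        rcases hC with ⟨h | h, h'⟩
        · exact ⟨h.1, h'⟩
        · exact absurd h' h.2.2.1
      refine ih _ ?_ (fun j => shf x a (F j)) rfl (fun j => shf_subset hxa (by simp [hx]) (hF j)) ?_
      · rw [← hP]
        apply sum_lt_sum (fun j _ => card_le_card (hsub j))
        refine ⟨i, mem_univ _, card_lt_card ?_⟩
        refine ⟨hsub i, fun hcon => ?_⟩
        have := hcon (mem_filter.2 ⟨h1, mem_insert_self _ _⟩)
        rw [mem_filter, mem_shf hxa] at this
        rcases this.1 with h | h
        · have h3 := h.2 (mem_insert_self _ _) (by simp [hxa, hxB])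
          rw [erase_insert haB] at h3
          exact h2 h3
        · exact h.1 h1
      · intro j
        have : (shf x a (F j)).card = (F j).card := UV.card_compression _ _ _
        rw [this]
        exact hcard j

end

theorem sum_DD (n : ℕ) (p : ℝ) (hp : 0 ≤ p) :
    ∑ k ∈ range (n + 1), (DD n k : ℝ) * (p ^ k * (1 - p) ^ (n - k)) ≤ p := by
  cases n with
  | zero => simpa [DD] using hp
  | succ n =>
    rw [sum_range_succ']
    simp only [DD]
    have h := add_pow p (1 - p) n
    rw [add_sub_cancel, one_pow] at h
    have : ∑ k ∈ range (n + 1), (Nat.choose n k : ℝ) * (p ^ (k + 1) * (1 - p) ^ (n + 1 - (k + 1)))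
        = p * ∑ k ∈ range (n + 1), p ^ k * (1 - p) ^ (n - k) * (Nat.choose n k : ℝ) := by
      rw [mul_sum]
      apply sum_congr rfl
      intro k _
      rw [Nat.add_sub_add_right]; ring
    rw [this, ← h]
    simp

theorem exists_slice {n : ℕ} (F : Finset (Finset (Fin n))) (p c : ℝ) (hp : 0 < p) (hp1 : p ≤ 1)
    (hc : 0 < c) (h : c * p < ∑ A ∈ F, p ^ A.card * (1 - p) ^ (n - A.card)) :
    ∃ k, c * DD n k < (F.filter (fun A => A.card = k)).card := by
  by_contra! hcon
  have h1 : ∑ A ∈ F, p ^ A.card * (1 - p) ^ (n - A.card) =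
      ∑ k ∈ range (n + 1), ((F.filter (fun A => A.card = k)).card : ℝ)
        * (p ^ k * (1 - p) ^ (n - k)) := by
    rw [← sum_fiberwise_of_maps_to (s := F) (t := range (n + 1)) (g := Finset.card)]
    · apply sum_congr rfl
      intro k _
      rw [← nsmul_eq_mul, ← sum_const]
      apply sum_congr rfl
      intro A hA
      rw [(mem_filter.1 hA).2]
    · intro A _
      have := card_finset_fin_le A
      simp; omega
  have h2 : ∑ k ∈ range (n + 1), ((F.filter (fun A => A.card = k)).card : ℝ)
        * (p ^ k * (1 - p) ^ (n - k)) ≤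
      c * ∑ k ∈ range (n + 1), (DD n k : ℝ) * (p ^ k * (1 - p) ^ (n - k)) := by
    rw [mul_sum]
    apply sum_le_sum
    intro k _
    rw [← mul_assoc c]
    have : 0 ≤ 1 - p := by linarith
    exact mul_le_mul_of_nonneg_right (hcon k) (by positivity)
  have h3 := mul_le_mul_of_nonneg_left (sum_DD n p hp.le) hc.le
  linarith

theorem stmt19 {n s : ℕ} (m : ℕ) (hms : m ≤ s)
    (p : Fin s → ℝ) (hp : ∀ i, 0 < p i) (hsum : ∑ i, p i ≤ 1 / 2)
    (𝓕 : Fin s → Finset (Finset (Fin n)))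
    (hmono : ∀ i, ∀ A ∈ 𝓕 i, ∀ B : Finset (Fin n), A ⊆ B → B ∈ 𝓕 i)
    (hdense1 : ∀ i : Fin s, (i : ℕ) < m →
      (3 : ℝ) * m * p i ≤ ∑ A ∈ 𝓕 i, (p i) ^ A.card * (1 - p i) ^ (n - A.card))
    (hdense2 : ∀ i : Fin s, m ≤ (i : ℕ) →
      (3 : ℝ) * s * p i ≤ ∑ A ∈ 𝓕 i, (p i) ^ A.card * (1 - p i) ^ (n - A.card)) :
    ∃ A : Fin s → Finset (Fin n), (∀ i, A i ∈ 𝓕 i) ∧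
      ∀ i j, i ≠ j → Disjoint (A i) (A j) := by
  let c : Fin s → ℝ := fun i => if (i : ℕ) < m then 2 * m else 2 * s
  have hc : ∀ i, 0 < c i := by
    intro i
    have hs : (0 : ℝ) < s := by exact_mod_cast i.pos
    by_cases h : (i : ℕ) < m
    · have : (0 : ℝ) < m := by exact_mod_cast (Nat.zero_le _).trans_lt h
      simp only [c, if_pos h]; positivity
    · simp only [c, if_neg h]; positivity
  have hcs : ∑ i, (c i)⁻¹ ≤ 1 := by
    have h1 : ∀ i : Fin s, (c i)⁻¹ ≤ (if (i : ℕ) < m then (2 * (m : ℝ))⁻¹ else 0) + (2 * (s : ℝ))⁻¹ := by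
      intro i
      by_cases h : (i : ℕ) < m
      · simp only [c, if_pos h]
        have : (0 : ℝ) ≤ (2 * (s : ℝ))⁻¹ := by positivity
        linarith
      · simp only [c, if_neg h]; simp
    have h2 : (univ.filter (fun i : Fin s => (i : ℕ) < m)).card ≤ m := by
      have : (univ.filter (fun i : Fin s => (i : ℕ) < m)).card ≤ (range m).card := by
        apply card_le_card_of_injOn (fun i : Fin s => (i : ℕ))
        · intro i hi
          simpa using hi
        · intro i _ j _ hij
          exact Fin.ext hij
      simpa using this
    have h3 : ∀ t : ℕ, (t : ℝ) * (2 * (t : ℝ))⁻¹ ≤ 1 / 2 := by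
      intro t
      rcases Nat.eq_zero_or_pos t with h | h
      · simp [h]
      · have : (0 : ℝ) < t := by exact_mod_cast h
        apply le_of_eq; field_simp
    refine (sum_le_sum fun i _ => h1 i).trans ?_
    rw [sum_add_distrib, ← sum_filter, sum_const, sum_const, nsmul_eq_mul, nsmul_eq_mul,
      card_univ, Fintype.card_fin]
    have h4 : ((univ.filter (fun i : Fin s => (i : ℕ) < m)).card : ℝ) * (2 * (m : ℝ))⁻¹
        ≤ m * (2 * (m : ℝ))⁻¹ :=
      mul_le_mul_of_nonneg_right (by exact_mod_cast h2) (by positivity)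
    linarith [h3 m, h3 s]
  have hsl : ∀ i, ∃ k, c i * DD n k < ((𝓕 i).filter (fun A => A.card = k)).card := by
    intro i
    apply exists_slice _ (p i) _ (hp i) _ (hc i)
    · have hci := mul_pos (hc i) (hp i)
      by_cases h : (i : ℕ) < m
      · have := hdense1 i h
        simp only [c, if_pos h] at hci ⊢
        linarith
      · have := hdense2 i (not_lt.1 h)
        simp only [c, if_neg h] at hci ⊢
        linarith
    · have := single_le_sum (f := p) (fun j _ => (hp j).le) (mem_univ i)
      linarith
  choose k hk using hsl
  obtain ⟨A, hA, hd⟩ := uniform_case c hc hcs (univ : Finset (Fin n)) k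
    (fun i => (𝓕 i).filter (fun A => A.card = k i))
    (fun i B hB => by
      rw [mem_powersetCard]
      exact ⟨subset_univ _, (mem_filter.1 hB).2⟩)
    (fun i => by simpa using hk i)
  exact ⟨A, fun i => (mem_filter.1 (hA i)).1, hd⟩
end
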